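/- Let (Z,ρ₀) be an antipodal space, ρ₁ ∈ M(Z), and δ ≥ 0, and suppose that (α|β)_{ρ₁} ≥ min((α|γ)_{ρ₁}, (γ|β)_{ρ₁}) − δ for all α, β, γ ∈ M(Z), where (x|y)_w := (1/2)(d_M(x,w) + d_M(y,w) − d_M(x,y)). Then ρ₁ is a K-quasi-metric with K = e^{δ}, i.e. ρ₁(ξ,η) ≤ e^{δ}·max(ρ₁(ξ,ζ), ρ₁(ζ,η)) for all ξ, η, ζ ∈ Z. -/

import Mathlib

open Filter Topology
open scoped Classical

variable {Z : Type*}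

/-- `Z` has at least four points. -/
def HasFourPoints (Z : Type*) : Prop :=
  ∃ a b c d : Z, a ≠ b ∧ a ≠ c ∧ a ≠ d ∧ b ≠ c ∧ b ≠ d ∧ c ≠ d

/-- A separating function on `Z`: continuous, symmetric, and positive. -/
structure IsSeparating [TopologicalSpace Z] (ρ : Z → Z → ℝ) : Prop where
  continuous : Continuous fun p : Z × Z => ρ p.1 p.2
  symm : ∀ ξ η, ρ ξ η = ρ η ξ
  nonneg : ∀ ξ η, 0 ≤ ρ ξ η
  eq_zero_iff : ∀ ξ η, ρ ξ η = 0 ↔ ξ = η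

/-- The cross-ratio of a quadruple of points with respect to `ρ`. -/
noncomputable def crossRatio (ρ : Z → Z → ℝ) (ξ ξ' η η' : Z) : ℝ :=
  ρ ξ η * ρ ξ' η' / (ρ ξ η' * ρ ξ' η)

/-- Two functions are Moebius equivalent if their cross-ratios agree on all quadruples
of pairwise distinct points. -/
def MoebiusEquiv (ρ₁ ρ₂ : Z → Z → ℝ) : Prop :=
  ∀ ξ ξ' η η' : Z, ξ ≠ ξ' → ξ ≠ η → ξ ≠ η' → ξ' ≠ η → ξ' ≠ η' → η ≠ η' →
    crossRatio ρ₁ ξ ξ' η η' = crossRatio ρ₂ ξ ξ' η η'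

/-- An antipodal function on `Z`: a separating function with values in `[0,1]` such that
every point has an antipode. -/
structure IsAntipodal [TopologicalSpace Z] (ρ : Z → Z → ℝ) : Prop where
  toIsSeparating : IsSeparating ρ
  le_one : ∀ ξ η, ρ ξ η ≤ 1
  antipode : ∀ ξ, ∃ η, ρ ξ η = 1

/-- The Moebius space `M(Z, ρ₀)`: antipodal functions Moebius equivalent to `ρ₀`. -/
def MoebiusSpace [TopologicalSpace Z] (ρ₀ : Z → Z → ℝ) : Set (Z → Z → ℝ) :=
  {ρ | IsAntipodal ρ ∧ MoebiusEquiv ρ₀ ρ}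

/-- The derivative `dρ₂/dρ₁`: the (unique, when it exists) positive continuous function
satisfying the geometric mean value theorem
`ρ₂(ξ,η)² = f(ξ) f(η) ρ₁(ξ,η)²`. -/
noncomputable def mDeriv [TopologicalSpace Z] (ρ₁ ρ₂ : Z → Z → ℝ) : Z → ℝ :=
  if h : ∃ f : Z → ℝ, Continuous f ∧ (∀ ξ, 0 < f ξ) ∧
      ∀ ξ η, ρ₂ ξ η ^ 2 = f ξ * f η * ρ₁ ξ η ^ 2
  then h.choose else fun _ => 1

/-- The metric `d_M(ρ₁, ρ₂) = ‖log (dρ₂/dρ₁)‖_∞` on the Moebius space. -/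
noncomputable def dM [TopologicalSpace Z] (ρ₁ ρ₂ : Z → Z → ℝ) : ℝ :=
  ⨆ ξ : Z, |Real.log (mDeriv ρ₁ ρ₂ ξ)|

/-- The discrepancy function `D_{ρ₁}(τ)(ξ) = max_{η ≠ ξ} (τ(ξ) + τ(η) + log ρ₁(ξ,η)²)`. -/
noncomputable def discrepancy [TopologicalSpace Z] (ρ₁ : Z → Z → ℝ) (τ : C(Z, ℝ))
    (ξ : Z) : ℝ :=
  ⨆ η : {η : Z // η ≠ ξ}, (τ ξ + τ η.1 + Real.log (ρ₁ ξ η.1 ^ 2))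

/-- `E_{ρ₁}(τ)(ξ,η) = e^{τ(ξ)/2} e^{τ(η)/2} ρ₁(ξ,η)`. -/
noncomputable def eMap [TopologicalSpace Z] (ρ₁ : Z → Z → ℝ) (τ : C(Z, ℝ)) :
    Z → Z → ℝ :=
  fun ξ η => Real.exp (τ ξ / 2) * Real.exp (τ η / 2) * ρ₁ ξ η

/-- A solution of the `ρ₁`-antipodal flow `dτ_t/dt = -D_{ρ₁}(τ_t)` on `[0, ∞)`. -/
def IsAntipodalFlowSol [TopologicalSpace Z] [CompactSpace Z]
    (ρ₁ : Z → Z → ℝ) (τ : ℝ → C(Z, ℝ)) : Prop :=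
  ∀ t ∈ Set.Ici (0 : ℝ), ∃ τ' : C(Z, ℝ),
    (∀ ξ, τ' ξ = -discrepancy ρ₁ (τ t) ξ) ∧
    HasDerivWithinAt τ τ' (Set.Ici (0 : ℝ)) t

/-- The antipodalization map `P_∞(τ₀, ρ₁) = E_{ρ₁}(τ_∞)`, where `τ_∞` is the limit as
`t → ∞` of the solution of the `ρ₁`-antipodal flow starting at `τ₀`. -/
noncomputable def antipodalization [TopologicalSpace Z] [CompactSpace Z]
    (ρ₁ : Z → Z → ℝ) (τ₀ : C(Z, ℝ)) : Z → Z → ℝ :=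
  if h : ∃ p : (ℝ → C(Z, ℝ)) × C(Z, ℝ), p.1 0 = τ₀ ∧ IsAntipodalFlowSol ρ₁ p.1 ∧
      Filter.Tendsto p.1 Filter.atTop (𝓝 p.2)
  then eMap ρ₁ h.choose.2 else ρ₁

/-- Every bounded function dominating `ρ²` has a minimal dominating function below it. -/
lemma exists_minimal_dominating (ρ : Z → Z → ℝ) (g : Z → ℝ) (hg : ∀ ξ, 0 ≤ g ξ)
    (hant : ∀ ξ, ∃ η, ρ ξ η = 1) (hρg : ∀ ξ η, ρ ξ η ^ 2 ≤ g ξ * g η) :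
    ∃ u : Z → ℝ, u ≤ g ∧
      Minimal (· ∈ {u : Z → ℝ | (∀ ξ, 0 ≤ u ξ) ∧ ∀ ξ η, ρ ξ η ^ 2 ≤ u ξ * u η}) u := by
  refine @zorn_le_nonempty₀ (Z → ℝ)ᵒᵈ _
    {u : Z → ℝ | (∀ ξ, 0 ≤ u ξ) ∧ ∀ ξ η, ρ ξ η ^ 2 ≤ u ξ * u η} ?_ g ⟨hg, hρg⟩
  intro c hc hchain y hy
  have hpos : ∀ u : Z → ℝ, u ∈ c → ∀ ξ, 0 < u ξ := by
    intro u hu ξ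
    obtain ⟨η, hη⟩ := hant ξ
    have h1 := (hc hu).2 ξ η
    rcases ((hc hu).1 ξ).lt_or_eq with h | h
    · exact h
    · rw [hη, ← h] at h1
      norm_num at h1
  have hmix : ∀ u : Z → ℝ, u ∈ c → ∀ v : Z → ℝ, v ∈ c → ∀ ξ η, ρ ξ η ^ 2 ≤ u ξ * v η := by
    intro u hu v hv ξ η
    rcases hchain.total hu hv with h | h
    · have h' : v ξ ≤ u ξ := h ξ
      exact ((hc hv).2 ξ η).trans (mul_le_mul_of_nonneg_right h' (hpos v hv η).le)
    · have h' : u η ≤ v η := h η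
      exact ((hc hu).2 ξ η).trans (mul_le_mul_of_nonneg_left h' (hpos u hu ξ).le)
  have : Nonempty c := ⟨⟨y, hy⟩⟩
  have hbdd : ∀ ξ, BddBelow (Set.range fun u : c => (u.1 : Z → ℝ) ξ) := fun ξ =>
    ⟨0, by rintro _ ⟨u, rfl⟩; exact (hpos u.1 u.2 ξ).le⟩
  have hnn : ∀ ξ, 0 ≤ ⨅ u : c, (u.1 : Z → ℝ) ξ := fun ξ =>
    le_ciInf fun u => (hpos u.1 u.2 ξ).le
  refine ⟨fun ξ => ⨅ u : c, (u.1 : Z → ℝ) ξ, ⟨hnn, fun ξ η => ?_⟩,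
    fun u hu ξ => ciInf_le (hbdd ξ) ⟨u, hu⟩⟩
  rw [Real.mul_iInf_of_nonneg (hnn ξ)]
  refine le_ciInf fun v => ?_
  rw [Real.iInf_mul_of_nonneg (hpos v.1 v.2 η).le]
  exact le_ciInf fun u => hmix u.1 u.2 v.1 v.2 ξ η

/-- `u` is the reciprocal derivative of an antipodal function conformal to `ρ`. -/
structure IsTight [TopologicalSpace Z] (ρ : Z → Z → ℝ) (u : Z → ℝ) : Prop where
  continuous : Continuous u
  pos : ∀ ξ, 0 < u ξ
  dominates : ∀ ξ η, ρ ξ η ^ 2 ≤ u ξ * u η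
  attained : ∀ ξ, ∃ η, ρ ξ η ^ 2 = u ξ * u η

lemma exists_isTight_le [TopologicalSpace Z] [CompactSpace Z] {ρ : Z → Z → ℝ}
    (hρ : IsAntipodal ρ) {g : Z → ℝ} {T : ℝ} (hT : 0 < T) (hg : ∀ ξ, 0 ≤ g ξ)
    (hgT : ∀ ξ, g ξ ≤ T) (hρg : ∀ ξ η, ρ ξ η ^ 2 ≤ g ξ * g η) :
    ∃ u : Z → ℝ, IsTight ρ u ∧ (∀ ξ, u ξ ≤ g ξ) ∧ ∀ ξ, 1 / T ≤ u ξ := by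
  obtain ⟨u, hug, ⟨hu0, hdom⟩, hmin⟩ := exists_minimal_dominating ρ g hg hρ.antipode hρg
  have huT : ∀ ξ, u ξ ≤ T := fun ξ => (hug ξ).trans (hgT ξ)
  have hlow : ∀ ξ, 1 / T ≤ u ξ := by
    intro ξ
    obtain ⟨η, hη⟩ := hρ.antipode ξ
    have h1 := hdom ξ η
    rw [hη] at h1
    rw [div_le_iff₀ hT]
    nlinarith [mul_le_mul_of_nonneg_left (huT η) (hu0 ξ)]
  have hpos : ∀ ξ, 0 < u ξ := fun ξ => (one_div_pos.2 hT).trans_le (hlow ξ)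
  have hlt : ∀ ξ c, 0 ≤ c → c < u ξ → ∃ η, c * u η < ρ ξ η ^ 2 := by
    intro ξ c hc hcu
    by_contra! hcon
    have hle : Function.update u ξ c ≤ u := by
      intro θ
      by_cases h : θ = ξ
      · subst h; simpa using hcu.le
      · simp [h]
    have hmem : Function.update u ξ c ∈
        {u : Z → ℝ | (∀ ξ, 0 ≤ u ξ) ∧ ∀ ξ η, ρ ξ η ^ 2 ≤ u ξ * u η} := by
      refine ⟨fun θ => ?_, fun θ η => ?_⟩
      · by_cases h : θ = ξ
        · subst h; simpa using hc
        · simpa [h] using hu0 θ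
      · by_cases h : θ = ξ <;> by_cases h' : η = ξ
        · subst h h'
          rw [(hρ.toIsSeparating.eq_zero_iff _ _).2 rfl]
          simpa using mul_nonneg hc hc
        · subst h
          simpa [h'] using hcon η
        · subst h'
          have := hcon θ
          rw [hρ.toIsSeparating.symm] at this
          simpa [h, mul_comm] using this
        · simpa [h, h'] using hdom θ η
    have := hmin hmem hle ξ
    simp only [Function.update_self] at this
    linarith
  have hρc := hρ.toIsSeparating.continuous
  have hcont : Continuous u := by
    let F : C(Z, C(Z, ℝ)) := ContinuousMap.curry ⟨fun p : Z × Z => ρ p.1 p.2 ^ 2, hρc.pow 2⟩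
    have hF : ∀ ξ ξ' η, ρ ξ η ^ 2 ≤ ρ ξ' η ^ 2 + dist (F ξ) (F ξ') := by
      intro ξ ξ' η
      have h := (F ξ).dist_apply_le_dist (g := F ξ') η
      rw [Real.dist_eq] at h
      have h' : F ξ η - F ξ' η = ρ ξ η ^ 2 - ρ ξ' η ^ 2 := rfl
      linarith [le_abs_self (F ξ η - F ξ' η)]
    have key : ∀ ξ ξ', u ξ ≤ u ξ' + T * dist (F ξ) (F ξ') := by
      intro ξ ξ'
      by_contra! hcon
      have hd : 0 ≤ dist (F ξ) (F ξ') := dist_nonneg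
      obtain ⟨η, hη⟩ := hlt ξ _ (add_nonneg (hu0 ξ') (mul_nonneg hT.le hd)) hcon
      have h1 : 1 ≤ T * u η := by
        have := (div_le_iff₀ hT).1 (hlow η)
        linarith
      nlinarith [hF ξ ξ' η, hdom ξ' η, mul_le_mul_of_nonneg_right h1 hd]
    rw [continuous_iff_continuousAt]
    intro ξ
    rw [ContinuousAt, tendsto_iff_dist_tendsto_zero]
    have hlim : Tendsto (fun ξ' => T * dist (F ξ') (F ξ)) (𝓝 ξ) (𝓝 0) := by
      have := ((F.continuous.dist continuous_const).const_mul T :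
        Continuous fun ξ' => T * dist (F ξ') (F ξ)).tendsto ξ
      simpa using this
    refine squeeze_zero (fun _ => dist_nonneg) (fun ξ' => ?_) hlim
    rw [Real.dist_eq, abs_sub_le_iff]
    have h1 := key ξ' ξ
    have h2 := key ξ ξ'
    rw [dist_comm] at h2
    constructor <;> linarith
  refine ⟨u, ⟨hcont, hpos, hdom, fun ξ => ?_⟩, hug, hlow⟩
  have hfc : Continuous fun η => ρ ξ η ^ 2 / u η :=
    ((hρc.comp (Continuous.prodMk_right ξ)).pow 2).div hcont fun η => (hpos η).ne'
  obtain ⟨η, -, hη⟩ := isCompact_univ.exists_isMaxOn ⟨ξ, Set.mem_univ ξ⟩ hfc.continuousOn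
  refine ⟨η, le_antisymm (hdom ξ η) ?_⟩
  by_contra! hcon
  obtain ⟨θ, hθ⟩ := hlt ξ (ρ ξ η ^ 2 / u η) (div_nonneg (sq_nonneg _) (hu0 η))
    ((div_lt_iff₀ (hpos η)).2 hcon)
  have := hη (Set.mem_univ θ)
  simp only [Set.mem_ofPred_eq] at this
  rw [div_le_iff₀ (hpos θ)] at this
  linarith

/-- The conformal change of `ρ` with derivative `1 / u`. -/
noncomputable def conformal (ρ : Z → Z → ℝ) (u : Z → ℝ) : Z → Z → ℝ :=
  fun ξ η => ρ ξ η / (√(u ξ) * √(u η))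

lemma conformal_sq {ρ : Z → Z → ℝ} {u : Z → ℝ} (hu : ∀ ξ, 0 < u ξ) (ξ η : Z) :
    conformal ρ u ξ η ^ 2 = ρ ξ η ^ 2 / (u ξ * u η) := by
  rw [conformal, div_pow, mul_pow, Real.sq_sqrt (hu ξ).le, Real.sq_sqrt (hu η).le]

lemma conformal_mem [TopologicalSpace Z] {ρ₀ ρ : Z → Z → ℝ}
    (hρ : ρ ∈ MoebiusSpace ρ₀) {u : Z → ℝ} (hu : IsTight ρ u) :
    conformal ρ u ∈ MoebiusSpace ρ₀ := by
  obtain ⟨hant, hmoeb⟩ := hρ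
  have hs : ∀ ξ, 0 < √(u ξ) := fun ξ => Real.sqrt_pos.2 (hu.pos ξ)
  have hnn : ∀ ξ η, 0 ≤ conformal ρ u ξ η := fun ξ η =>
    div_nonneg (hant.toIsSeparating.nonneg _ _) (mul_pos (hs ξ) (hs η)).le
  have hsc : Continuous fun ξ => √(u ξ) := hu.continuous.sqrt
  refine ⟨⟨⟨?_, ?_, hnn, ?_⟩, ?_, ?_⟩, ?_⟩
  · exact hant.toIsSeparating.continuous.div
      ((hsc.comp continuous_fst).mul (hsc.comp continuous_snd))
      fun p => (mul_pos (hs p.1) (hs p.2)).ne'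
  · intro ξ η
    rw [conformal, conformal, hant.toIsSeparating.symm, mul_comm]
  · intro ξ η
    rw [conformal, div_eq_zero_iff, or_iff_left (mul_pos (hs ξ) (hs η)).ne']
    exact hant.toIsSeparating.eq_zero_iff ξ η
  · intro ξ η
    rw [← sq_le_one_iff₀ (hnn ξ η), conformal_sq hu.pos,
      div_le_one (mul_pos (hu.pos ξ) (hu.pos η))]
    exact hu.dominates ξ η
  · intro ξ
    obtain ⟨η, hη⟩ := hu.attained ξ
    refine ⟨η, ?_⟩
    rw [← pow_eq_one_iff_of_nonneg (hnn ξ η) two_ne_zero,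
      conformal_sq hu.pos, hη, div_self (mul_pos (hu.pos ξ) (hu.pos η)).ne']
  · intro ξ ξ' η η' h1 h2 h3 h4 h5 h6
    rw [hmoeb ξ ξ' η η' h1 h2 h3 h4 h5 h6]
    have e1 := (hs ξ).ne'
    have e2 := (hs ξ').ne'
    have e3 := (hs η).ne'
    have e4 := (hs η').ne'
    have p1 := mt (hant.toIsSeparating.eq_zero_iff ξ η').1 h3
    have p2 := mt (hant.toIsSeparating.eq_zero_iff ξ' η).1 h4
    simp only [crossRatio, conformal]
    field_simp

lemma mDeriv_eq [TopologicalSpace Z] (h4 : HasFourPoints Z) {ρ₁ ρ₂ : Z → Z → ℝ}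
    (hρ₁ : ∀ ξ η, ρ₁ ξ η = 0 → ξ = η) {f : Z → ℝ} (hf : Continuous f)
    (hf0 : ∀ ξ, 0 < f ξ) (hfe : ∀ ξ η, ρ₂ ξ η ^ 2 = f ξ * f η * ρ₁ ξ η ^ 2) :
    mDeriv ρ₁ ρ₂ = f := by
  have h : ∃ f : Z → ℝ, Continuous f ∧ (∀ ξ, 0 < f ξ) ∧
      ∀ ξ η, ρ₂ ξ η ^ 2 = f ξ * f η * ρ₁ ξ η ^ 2 := ⟨f, hf, hf0, hfe⟩
  rw [mDeriv, dif_pos h]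
  obtain ⟨-, hk0, hke⟩ := h.choose_spec
  set k := h.choose
  have hprod : ∀ ξ η, ξ ≠ η → k ξ * k η = f ξ * f η := fun ξ η hne =>
    mul_right_cancel₀ (pow_ne_zero 2 (mt (hρ₁ ξ η) hne)) ((hke ξ η).symm.trans (hfe ξ η))
  have hthree : ∀ x y z, x ≠ y → x ≠ z → y ≠ z → k x = f x := by
    intro x y z hxy hxz hyz
    have h1 := hprod x y hxy
    have h2 := hprod x z hxz
    have h3 := hprod y z hyz
    have h5 : k x ^ 2 * (f y * f z) = f x ^ 2 * (f y * f z) := by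
      calc k x ^ 2 * (f y * f z) = (k x * k y) * (k x * k z) := by rw [← h3]; ring
        _ = f x ^ 2 * (f y * f z) := by rw [h1, h2]; ring
    have h6 := mul_right_cancel₀ (mul_pos (hf0 y) (hf0 z)).ne' h5
    exact (pow_left_inj₀ (hk0 x).le (hf0 x).le two_ne_zero).1 h6
  obtain ⟨a, b, c, -, hab, hac, -, hbc, -, -⟩ := h4
  funext x
  by_cases hxa : x = a
  · subst hxa; exact hthree x b c hab hac hbc
  by_cases hxb : x = b
  · subst hxb; exact hthree x a c hxa hbc hac
  exact hthree x a b hxa hxb hab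

lemma dM_conformal [TopologicalSpace Z] (h4 : HasFourPoints Z) {ρ : Z → Z → ℝ}
    (hρ : IsAntipodal ρ) {u v : Z → ℝ} (hu : IsTight ρ u) (hv : IsTight ρ v) :
    dM (conformal ρ u) (conformal ρ v) = ⨆ ξ, |Real.log (u ξ) - Real.log (v ξ)| := by
  have hd : mDeriv (conformal ρ u) (conformal ρ v) = fun ξ => u ξ / v ξ := by
    refine mDeriv_eq h4 (fun ξ η h => ?_)
      (hu.continuous.div hv.continuous fun ξ => (hv.pos ξ).ne')
      (fun ξ => div_pos (hu.pos ξ) (hv.pos ξ)) fun ξ η => ?_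
    · have hs : √(u ξ) * √(u η) ≠ 0 :=
        (mul_pos (Real.sqrt_pos.2 (hu.pos ξ)) (Real.sqrt_pos.2 (hu.pos η))).ne'
      rw [conformal, div_eq_zero_iff, or_iff_left hs] at h
      exact (hρ.toIsSeparating.eq_zero_iff ξ η).1 h
    · rw [conformal_sq hu.pos, conformal_sq hv.pos]
      have e1 := (hu.pos ξ).ne'
      have e2 := (hu.pos η).ne'
      have e3 := (hv.pos ξ).ne'
      have e4 := (hv.pos η).ne'
      field_simp
  rw [dM, hd]
  simp only [Real.log_div (hu.pos _).ne' (hv.pos _).ne']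

lemma conformal_one (ρ : Z → Z → ℝ) : conformal ρ (fun _ => 1) = ρ := by
  funext ξ η
  simp [conformal]

lemma isTight_one [TopologicalSpace Z] {ρ : Z → Z → ℝ} (hρ : IsAntipodal ρ) :
    IsTight ρ (fun _ => 1) := by
  refine ⟨continuous_const, fun _ => one_pos, fun ξ η => ?_, fun ξ => ?_⟩
  · have := pow_le_one₀ (n := 2) (hρ.toIsSeparating.nonneg ξ η) (hρ.le_one ξ η)
    simpa using this
  · obtain ⟨η, hη⟩ := hρ.antipode ξ
    exact ⟨η, by simp [hη]⟩

/-- `u` is the reciprocal derivative of a point at distance `log T` from `ρ` in the direction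
of the boundary point `a`, following the Busemann function outside the `r`-ball around `a`. -/
structure IsRay [TopologicalSpace Z] (ρ : Z → Z → ℝ) (r T : ℝ) (a : Z) (u : Z → ℝ) : Prop where
  tight : IsTight ρ u
  lower : ∀ ξ, 1 / T ≤ u ξ
  upper : ∀ ξ, u ξ ≤ T
  center : u a ≤ 1 / T
  far : ∀ θ, r ≤ ρ a θ → u θ ≤ T * ρ a θ ^ 2

lemma exists_isRay [TopologicalSpace Z] [CompactSpace Z] {ρ : Z → Z → ℝ}
    (hρ : IsAntipodal ρ) (a : Z) {r T : ℝ} (hr : 0 < r) (hT : 1 ≤ T) (hrT : 1 ≤ T * r ^ 2) :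
    ∃ u : Z → ℝ, IsRay ρ r T a u := by
  have hT0 : 0 < T := one_pos.trans_le hT
  have hnn := hρ.toIsSeparating.nonneg
  have hsq : ∀ ξ η, ρ ξ η ^ 2 ≤ 1 := fun ξ η => pow_le_one₀ (hnn ξ η) (hρ.le_one ξ η)
  have hself : ∀ ξ, ρ ξ ξ = 0 := fun ξ => (hρ.toIsSeparating.eq_zero_iff ξ ξ).2 rfl
  set g : Z → ℝ := fun θ => if θ = a then 1 / T else if ρ a θ < r then T else T * ρ a θ ^ 2
    with hg
  have hga : g a = 1 / T := by simp [hg]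
  have hg1 : ∀ θ, θ ≠ a → 1 ≤ g θ := by
    intro θ hθ
    simp only [hg, if_neg hθ]
    split_ifs with h
    · exact hT
    · have : r ^ 2 ≤ ρ a θ ^ 2 := pow_le_pow_left₀ hr.le (not_lt.1 h) 2
      nlinarith
  have hgl : ∀ θ, θ ≠ a → T * ρ a θ ^ 2 ≤ g θ := by
    intro θ hθ
    simp only [hg, if_neg hθ]
    split_ifs with h
    · nlinarith [hsq a θ]
    · exact le_rfl
  have hgu : ∀ θ, g θ ≤ T := by
    intro θ
    simp only [hg]
    split_ifs
    · exact (div_le_one hT0).2 hT |>.trans hT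
    · exact le_rfl
    · nlinarith [hsq a θ]
  have hg0 : ∀ θ, 0 ≤ g θ := by
    intro θ
    by_cases h : θ = a
    · rw [h, hga]; positivity
    · exact zero_le_one.trans (hg1 θ h)
  have hcenter : ∀ θ, θ ≠ a → ρ a θ ^ 2 ≤ g a * g θ := by
    intro θ hθ
    rw [hga, one_div, inv_mul_eq_div, le_div_iff₀ hT0, mul_comm]
    exact hgl θ hθ
  obtain ⟨u, hu, hug, hul⟩ := exists_isTight_le hρ hT0 hg0 hgu (by
    intro ξ η
    by_cases h : ξ = a <;> by_cases h' : η = a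
    · subst h h'
      rw [hself]
      simpa using mul_nonneg (hg0 η) (hg0 η)
    · subst h; exact hcenter η h'
    · subst h'; rw [hρ.toIsSeparating.symm, mul_comm]; exact hcenter ξ h
    · nlinarith [hsq ξ η, hg1 ξ h, hg1 η h'])
  refine ⟨u, hu, hul, fun ξ => (hug ξ).trans (hgu ξ), (hug a).trans_eq hga, fun θ hθ => ?_⟩
  have hne : θ ≠ a := by
    rintro rfl
    rw [hself] at hθ
    linarith
  refine (hug θ).trans_eq ?_
  simp [hg, hne, not_lt.2 hθ]

lemma eventually_lt_radius_mem [TopologicalSpace Z] [CompactSpace Z] {ρ : Z → Z → ℝ}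
    (hρ : IsAntipodal ρ) (b : Z) {W : Set Z} (hW : W ∈ 𝓝 b) :
    ∀ᶠ r in 𝓝[>] (0 : ℝ), ∀ θ, ρ b θ < r → θ ∈ W := by
  obtain ⟨V, hVW, hVo, hbV⟩ := mem_nhds_iff.1 hW
  have hc : Continuous fun θ => ρ b θ :=
    hρ.toIsSeparating.continuous.comp (Continuous.prodMk_right b)
  rcases (Vᶜ).eq_empty_or_nonempty with h | h
  · refine Eventually.of_forall fun r θ _ => hVW ?_
    by_contra hθ
    exact (h ▸ hθ : θ ∈ (∅ : Set Z))
  · obtain ⟨m, hmV, hm⟩ := hVo.isClosed_compl.isCompact.exists_isMinOn h hc.continuousOn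
    have hpos : 0 < ρ b m := by
      refine (hρ.toIsSeparating.nonneg b m).lt_of_ne fun h0 => hmV ?_
      rwa [← (hρ.toIsSeparating.eq_zero_iff b m).1 h0.symm]
    filter_upwards [Ioo_mem_nhdsGT hpos] with r hr θ hθ
    refine hVW ?_
    by_contra hθV
    have : ρ b m ≤ ρ b θ := hm hθV
    linarith [hr.2]

/-- At radius `r`, the function `ρ a ·` is bounded below by `r` and does not exceed `ρ a b`
by more than the factor `e^ε` on the `r`-ball around `b`. -/
def IsGoodRadius (ρ : Z → Z → ℝ) (ε : ℝ) (a b : Z) (r : ℝ) : Prop :=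
  r ≤ ρ a b ∧ ∀ θ, ρ b θ < r → r ≤ ρ a θ ∧ ρ a θ ≤ ρ a b * Real.exp ε

lemma eventually_isGoodRadius [TopologicalSpace Z] [CompactSpace Z] {ρ : Z → Z → ℝ}
    (hρ : IsAntipodal ρ) {ε : ℝ} (hε : 0 < ε) {a b : Z} (hab : a ≠ b) :
    ∀ᶠ r in 𝓝[>] (0 : ℝ), IsGoodRadius ρ ε a b r := by
  have hpos : 0 < ρ a b := (hρ.toIsSeparating.nonneg a b).lt_of_ne fun h =>
    hab ((hρ.toIsSeparating.eq_zero_iff a b).1 h.symm)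
  have hc : Continuous fun θ => ρ a θ :=
    hρ.toIsSeparating.continuous.comp (Continuous.prodMk_right a)
  have h1 : ρ a b < ρ a b * Real.exp ε := by
    have := Real.one_lt_exp_iff.2 hε
    nlinarith
  have hW := hc.continuousAt.preimage_mem_nhds
    (Ioo_mem_nhds (half_lt_self hpos) h1 : Set.Ioo _ _ ∈ 𝓝 (ρ a b))
  filter_upwards [eventually_lt_radius_mem hρ b hW, Ioo_mem_nhdsGT (half_pos hpos)] with r hr hr'
  refine ⟨by linarith [hr'.2], fun θ hθ => ?_⟩
  have := hr θ hθ
  exact ⟨hr'.2.le.trans this.1.le, this.2.le⟩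

namespace IsRay

variable [TopologicalSpace Z] {ρ : Z → Z → ℝ} {r T : ℝ} {a b : Z} {u v : Z → ℝ}

lemma neg_log_le (h : IsRay ρ r T a u) (hT : 0 < T) (ξ : Z) : -Real.log T ≤ Real.log (u ξ) := by
  have := Real.log_le_log (by positivity) (h.lower ξ)
  rwa [one_div, Real.log_inv] at this

lemma log_le (h : IsRay ρ r T a u) (ξ : Z) : Real.log (u ξ) ≤ Real.log T :=
  Real.log_le_log (h.tight.pos ξ) (h.upper ξ)

lemma log_center (h : IsRay ρ r T a u) : Real.log (u a) = -Real.log T := by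
  rw [le_antisymm h.center (h.lower a), one_div, Real.log_inv]

lemma dM_basepoint (h4 : HasFourPoints Z) (hρ : IsAntipodal ρ) (h : IsRay ρ r T a u)
    (hT : 1 ≤ T) : dM (conformal ρ u) ρ = Real.log T := by
  have hT0 : 0 < T := one_pos.trans_le hT
  have hd := dM_conformal h4 hρ h.tight (isTight_one hρ)
  rw [conformal_one] at hd
  rw [hd]
  have hle : ∀ ξ, |Real.log (u ξ) - Real.log 1| ≤ Real.log T := by
    intro ξ
    rw [Real.log_one, sub_zero, abs_le]
    exact ⟨h.neg_log_le hT0 ξ, h.log_le ξ⟩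
  have : Nonempty Z := ⟨a⟩
  refine le_antisymm (ciSup_le hle)
    (le_ciSup_of_le ⟨_, by rintro _ ⟨ξ, rfl⟩; exact hle ξ⟩ a ?_)
  rw [h.log_center, Real.log_one, sub_zero, abs_neg]
  exact le_abs_self _

lemma le_dM (h4 : HasFourPoints Z) (hρ : IsAntipodal ρ) (ha : IsRay ρ r T a u)
    (hb : IsRay ρ r T b v) (hT : 0 < T) (hab : 0 < ρ a b) :
    2 * Real.log T + 2 * Real.log (ρ a b) ≤ dM (conformal ρ u) (conformal ρ v) := by
  rw [dM_conformal h4 hρ ha.tight hb.tight]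
  refine le_ciSup_of_le ⟨2 * Real.log T, ?_⟩ b ?_
  · rintro _ ⟨ξ, rfl⟩
    have := ha.neg_log_le hT ξ
    have := hb.neg_log_le hT ξ
    have := ha.log_le ξ
    have := hb.log_le ξ
    exact abs_le.2 ⟨by linarith, by linarith⟩
  · have h1 := Real.log_le_log (by positivity) (ha.tight.dominates a b)
    rw [Real.log_mul (ha.tight.pos a).ne' (ha.tight.pos b).ne', Real.log_pow,
      ha.log_center] at h1
    push_cast at h1
    refine le_trans ?_ (le_abs_self _)
    rw [hb.log_center]
    linarith

lemma log_sub_log_le (ha : IsRay ρ r T a u) (hb : IsRay ρ r T b v)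
    (hr : 0 < r) (hT : T = 1 / r ^ 2) {ε : ℝ} (hε : 0 < ε) (hgood : IsGoodRadius ρ ε a b r)
    (θ : Z) :
    Real.log (u θ) - Real.log (v θ) ≤ 2 * Real.log T + 2 * Real.log (ρ a b) + 2 * ε := by
  have hT0 : 0 < T := by rw [hT]; positivity
  have hab : 0 < ρ a b := hr.trans_le hgood.1
  have hlogT : Real.log T = -(2 * Real.log r) := by
    rw [hT, one_div, Real.log_inv, Real.log_pow]; push_cast; ring
  by_cases h : ρ b θ < r
  · obtain ⟨h1, h2⟩ := hgood.2 θ h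
    have hpos : 0 < ρ a θ := hr.trans_le h1
    have h3 := Real.log_le_log (ha.tight.pos θ) (ha.far θ h1)
    rw [Real.log_mul hT0.ne' (by positivity), Real.log_pow] at h3
    have h4 := Real.log_le_log hpos h2
    rw [Real.log_mul hab.ne' (Real.exp_pos ε).ne', Real.log_exp] at h4
    have h5 := hb.neg_log_le hT0 θ
    push_cast at h3
    linarith
  · have hbθ : 0 < ρ b θ := hr.trans_le (not_lt.1 h)
    have h1 := Real.log_le_log (by positivity) (hb.tight.dominates b θ)
    rw [Real.log_mul (hb.tight.pos b).ne' (hb.tight.pos θ).ne', Real.log_pow,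
      hb.log_center] at h1
    have h2 := Real.log_le_log hr (not_lt.1 h)
    have h3 := Real.log_le_log hr hgood.1
    have h4 := ha.log_le θ
    push_cast at h1
    linarith

lemma dM_le (h4 : HasFourPoints Z) (hρ : IsAntipodal ρ) (ha : IsRay ρ r T a u)
    (hb : IsRay ρ r T b v) (hr : 0 < r) (hT : T = 1 / r ^ 2) {ε : ℝ} (hε : 0 < ε)
    (hab : IsGoodRadius ρ ε a b r) (hba : IsGoodRadius ρ ε b a r) :
    dM (conformal ρ u) (conformal ρ v) ≤
      2 * Real.log T + 2 * Real.log (ρ a b) + 2 * ε := by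
  rw [dM_conformal h4 hρ ha.tight hb.tight]
  have : Nonempty Z := ⟨a⟩
  refine ciSup_le fun θ => abs_sub_le_iff.2 ⟨ha.log_sub_log_le hb hr hT hε hab θ, ?_⟩
  rw [hρ.toIsSeparating.symm a b]
  exact hb.log_sub_log_le ha hr hT hε hba θ

end IsRay

theorem statement18 [TopologicalSpace Z] [CompactSpace Z]
    [TopologicalSpace.MetrizableSpace Z] (h4 : HasFourPoints Z)
    (ρ₀ : Z → Z → ℝ) (h₀ : IsAntipodal ρ₀)
    (ρ₁ : Z → Z → ℝ) (hρ₁ : ρ₁ ∈ MoebiusSpace ρ₀) (δ : ℝ) (hδ : 0 ≤ δ)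
    (hhyp : ∀ α β γ : Z → Z → ℝ, α ∈ MoebiusSpace ρ₀ → β ∈ MoebiusSpace ρ₀ →
      γ ∈ MoebiusSpace ρ₀ →
      (dM α ρ₁ + dM β ρ₁ - dM α β) / 2 ≥
        min ((dM α ρ₁ + dM γ ρ₁ - dM α γ) / 2) ((dM γ ρ₁ + dM β ρ₁ - dM γ β) / 2) - δ) :
    ∀ ξ η ζ : Z, ρ₁ ξ η ≤ Real.exp δ * max (ρ₁ ξ ζ) (ρ₁ ζ η) := by
  have hρ := hρ₁.1
  have hpos : ∀ x y, x ≠ y → 0 < ρ₁ x y := fun x y hxy =>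
    (hρ.toIsSeparating.nonneg x y).lt_of_ne fun h =>
      hxy ((hρ.toIsSeparating.eq_zero_iff x y).1 h.symm)
  intro ξ η ζ
  have hexp : 1 ≤ Real.exp δ := Real.one_le_exp hδ
  have hmax : 0 ≤ max (ρ₁ ξ ζ) (ρ₁ ζ η) :=
    (hρ.toIsSeparating.nonneg ξ ζ).trans (le_max_left _ _)
  by_cases hξη : ξ = η
  · subst hξη
    rw [(hρ.toIsSeparating.eq_zero_iff ξ ξ).2 rfl]
    positivity
  by_cases hξζ : ξ = ζ
  · subst hξζ
    exact (le_max_right _ _).trans (le_mul_of_one_le_left hmax hexp)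
  by_cases hζη : ζ = η
  · subst hζη
    exact (le_max_left _ _).trans (le_mul_of_one_le_left hmax hexp)
  have key : ∀ ε > 0, Real.log (ρ₁ ξ η) ≤
      max (Real.log (ρ₁ ξ ζ)) (Real.log (ρ₁ ζ η)) + δ + ε := by
    intro ε hε
    obtain ⟨r, g₁, g₂, g₃, g₄, hr⟩ := ((eventually_isGoodRadius hρ hε hξζ).and
      ((eventually_isGoodRadius hρ hε (Ne.symm hξζ)).and
      ((eventually_isGoodRadius hρ hε hζη).and
      ((eventually_isGoodRadius hρ hε (Ne.symm hζη)).and self_mem_nhdsWithin)))).exists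
    have hr : 0 < r := hr
    have hr1 : r ≤ 1 := g₁.1.trans (hρ.le_one _ _)
    obtain ⟨T, hT⟩ : ∃ T : ℝ, T = 1 / r ^ 2 := ⟨_, rfl⟩
    have hrT : T * r ^ 2 = 1 := by rw [hT]; field_simp
    have hT1 : 1 ≤ T := by
      rw [hT, le_div_iff₀ (by positivity), one_mul]
      exact pow_le_one₀ hr.le hr1
    have hT0 : 0 < T := one_pos.trans_le hT1
    obtain ⟨u, hu⟩ := exists_isRay hρ ξ hr hT1 hrT.ge
    obtain ⟨v, hv⟩ := exists_isRay hρ η hr hT1 hrT.ge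
    obtain ⟨w, hw⟩ := exists_isRay hρ ζ hr hT1 hrT.ge
    have h := hhyp _ _ _ (conformal_mem hρ₁ hu.tight) (conformal_mem hρ₁ hv.tight)
      (conformal_mem hρ₁ hw.tight)
    rw [hu.dM_basepoint h4 hρ hT1, hv.dM_basepoint h4 hρ hT1, hw.dM_basepoint h4 hρ hT1] at h
    have h1 := hu.le_dM h4 hρ hv hT0 (hpos ξ η hξη)
    have h2 := hu.dM_le h4 hρ hw hr hT hε g₁ g₂
    have h3 := hw.dM_le h4 hρ hv hr hT hε g₃ g₄
    have hm₁ := le_max_left (Real.log (ρ₁ ξ ζ)) (Real.log (ρ₁ ζ η))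
    have hm₂ := le_max_right (Real.log (ρ₁ ξ ζ)) (Real.log (ρ₁ ζ η))
    rw [ge_iff_le, sub_le_iff_le_add, min_le_iff] at h
    rcases h with h | h <;> linarith
  have hlog : Real.log (ρ₁ ξ η) ≤ max (Real.log (ρ₁ ξ ζ)) (Real.log (ρ₁ ζ η)) + δ :=
    le_of_forall_pos_le_add key
  have hfin : ∀ x, 0 < x → Real.log (ρ₁ ξ η) ≤ Real.log x + δ → ρ₁ ξ η ≤ Real.exp δ * x := by
    intro x hx h
    rw [← Real.log_le_log_iff (hpos ξ η hξη) (by positivity),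
      Real.log_mul (Real.exp_pos δ).ne' hx.ne', Real.log_exp]
    linarith
  rcases max_choice (Real.log (ρ₁ ξ ζ)) (Real.log (ρ₁ ζ η)) with h | h <;> rw [h] at hlog
  · exact (hfin _ (hpos _ _ hξζ) hlog).trans
      (mul_le_mul_of_nonneg_left (le_max_left _ _) (Real.exp_pos δ).le)
  · exact (hfin _ (hpos _ _ hζη) hlog).trans
      (mul_le_mul_of_nonneg_left (le_max_right _ _) (Real.exp_pos δ).le)
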